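/- Assume (A1) and let ε > 0. Set C₁ := ε² max_{ℝ}|g''| + (max_{ℝ} f)·√(ε² max_{ℝ}(g')² + 1) + 2(n−1)/min_{ℝ} g, σ₁ := ε² (min_{ℝ} g)/(2C₁), and define ψ⁺(x,t) := ε g(x) + (C₁/ε) t and ψ⁻(x,t) := ε g(x) − (C₁/ε) t. Then for all x ∈ ℝ and all t > 0, ψ⁺_t − ψ⁺_xx/((ψ⁺_x)² + 1) + (n−1)/ψ⁺ − (1/ε) f(x) √((ψ⁺_x)² + 1) > 0 (ψ⁺ is a supersolution), and for all x ∈ ℝ and all t ∈ (0, σ₁], ψ⁻(x,t) ≥ ε (min_{ℝ} g)/2 > 0 and ψ⁻_t − ψ⁻_xx/((ψ⁻_x)² + 1) + (n−1)/ψ⁻ − (1/ε) f(x) √((ψ⁻_x)² + 1) ≤ 0 (ψ⁻ is a subsolution). -/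

import Mathlib

open Real Set Filter Topology

noncomputable section

/-- Partial derivative in the space variable `x`. -/
def pdx (u : ℝ → ℝ → ℝ) (x t : ℝ) : ℝ := deriv (fun y => u y t) x

/-- Second partial derivative in the space variable `x`. -/
def pdxx (u : ℝ → ℝ → ℝ) (x t : ℝ) : ℝ := deriv (fun y => pdx u y t) x

/-- Partial derivative in the time variable `t`. -/
def pdt (u : ℝ → ℝ → ℝ) (x t : ℝ) : ℝ := deriv (fun s => u x s) t

/-- Assumption (A1): `f` is `C¹`, `ℤ`-periodic and positive; `g` is `C²`, `ℤ`-periodic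
and positive. -/
def A1 (f g : ℝ → ℝ) : Prop :=
  ContDiff ℝ 1 f ∧ (∀ x, f (x + 1) = f x) ∧ (∀ x, 0 < f x) ∧
  ContDiff ℝ 2 g ∧ (∀ x, g (x + 1) = g x) ∧ (∀ x, 0 < g x)

/-- A positive classical solution of the scaled problem on `ℝ × [0, T)`, where
`T : EReal` with `0 < T ≤ ∞`:
`u_t = u_xx/((u_x)² + 1) − (n−1)/u + (1/ε) f(x) √((u_x)² + 1)`, `u(x,0) = ε^α g(x)`. -/
structure IsSol (n : ℕ) (f g : ℝ → ℝ) (ε α : ℝ) (T : EReal) (u : ℝ → ℝ → ℝ) : Prop where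
  pos : ∀ x t : ℝ, 0 ≤ t → (t : EReal) < T → 0 < u x t
  cont : ContinuousOn (fun p : ℝ × ℝ => u p.1 p.2)
    {p : ℝ × ℝ | 0 ≤ p.2 ∧ (p.2 : EReal) < T}
  smooth : ContDiffOn ℝ (⊤ : ℕ∞) (fun p : ℝ × ℝ => u p.1 p.2)
    {p : ℝ × ℝ | 0 < p.2 ∧ (p.2 : EReal) < T}
  periodic : ∀ x t : ℝ, u (x + 1) t = u x t
  eqn : ∀ x t : ℝ, 0 < t → (t : EReal) < T →
    pdt u x t = pdxx u x t / ((pdx u x t) ^ 2 + 1) - ((n : ℝ) - 1) / u x t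
      + (1 / ε) * f x * Real.sqrt ((pdx u x t) ^ 2 + 1)
  init : ∀ x : ℝ, u x 0 = ε ^ α * g x

/-- The constant `C₁ = ε² max|g''| + (max f)·√(ε² max (g')² + 1) + 2(n−1)/min g`. -/
def C1 (n : ℕ) (f g : ℝ → ℝ) (ε : ℝ) : ℝ :=
  ε ^ 2 * sSup (Set.range fun x => |deriv (deriv g) x|) +
    sSup (Set.range f) * Real.sqrt (ε ^ 2 * sSup (Set.range fun x => (deriv g x) ^ 2) + 1) +
    2 * ((n : ℝ) - 1) / sInf (Set.range g)

theorem Function.Periodic.deriv {h : ℝ → ℝ} {c : ℝ} (hp : Function.Periodic h c) :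
    Function.Periodic (deriv h) c := fun x => by
  rw [← deriv_comp_add_const, show (fun y => h (y + c)) = h from funext hp]

theorem pdt_eq_of_affine {u : ℝ → ℝ → ℝ} {ε c : ℝ} {g : ℝ → ℝ}
    (hu : ∀ x t, u x t = ε * g x + c * t) (x t : ℝ) : pdt u x t = c := by
  have h : HasDerivAt (fun s => ε * g x + c * s) c t := by
    simpa using ((hasDerivAt_id t).const_mul c).const_add (ε * g x)
  simp only [pdt, hu, h.deriv]

theorem pdx_eq_of_affine {u : ℝ → ℝ → ℝ} {ε c : ℝ} {g : ℝ → ℝ}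
    (hu : ∀ x t, u x t = ε * g x + c * t) (x t : ℝ) : pdx u x t = ε * deriv g x := by
  simp only [pdx, hu, deriv_add_const, deriv_const_mul_field]

theorem pdxx_eq_of_affine {u : ℝ → ℝ → ℝ} {ε c : ℝ} {g : ℝ → ℝ}
    (hu : ∀ x t, u x t = ε * g x + c * t) (x t : ℝ) :
    pdxx u x t = ε * deriv (deriv g) x := by
  simp only [pdxx, pdx_eq_of_affine hu, deriv_const_mul_field]

theorem abs_div_sq_add_one_le (a p : ℝ) : |a / (p ^ 2 + 1)| ≤ |a| := by
  rw [abs_div, abs_of_pos (by positivity : (0 : ℝ) < p ^ 2 + 1)]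
  exact div_le_self (abs_nonneg a) (by nlinarith [sq_nonneg p])

/-- under (A1) and `ε > 0`, the functions `ψ⁺ = ε g + (C₁/ε)t` and
`ψ⁻ = ε g − (C₁/ε)t` are respectively a supersolution for all `t > 0`, and a positive
subsolution for `t ∈ (0, σ₁]` (with `ψ⁻ ≥ ε (min g)/2 > 0` there), of the scaled forced
mean curvature flow equation, where `σ₁ = ε² (min g)/(2C₁)`. -/
theorem initial_barriers (n : ℕ) (hn : 2 ≤ n) (f g : ℝ → ℝ) (hA1 : A1 f g)
    (ε : ℝ) (hε : 0 < ε) :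
    ∀ ψp ψm : ℝ → ℝ → ℝ,
      (∀ x t : ℝ, ψp x t = ε * g x + (C1 n f g ε / ε) * t) →
      (∀ x t : ℝ, ψm x t = ε * g x - (C1 n f g ε / ε) * t) →
      (∀ x t : ℝ, 0 < t →
        0 < pdt ψp x t - pdxx ψp x t / ((pdx ψp x t) ^ 2 + 1)
          + ((n : ℝ) - 1) / ψp x t
          - (1 / ε) * f x * Real.sqrt ((pdx ψp x t) ^ 2 + 1)) ∧
      (∀ x t : ℝ, 0 < t → t ≤ ε ^ 2 * sInf (Set.range g) / (2 * C1 n f g ε) →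
        (0 < ε * sInf (Set.range g) / 2 ∧ ε * sInf (Set.range g) / 2 ≤ ψm x t) ∧
        pdt ψm x t - pdxx ψm x t / ((pdx ψm x t) ^ 2 + 1)
          + ((n : ℝ) - 1) / ψm x t
          - (1 / ε) * f x * Real.sqrt ((pdx ψm x t) ^ 2 + 1) ≤ 0) := by
  obtain ⟨hf, hfp, hf0, hg, hgp, hg0⟩ := hA1
  intro ψp ψm hψp hψm
  have hψm' : ∀ x t : ℝ, ψm x t = ε * g x + (-(C1 n f g ε / ε)) * t := fun x t => by
    rw [hψm]; ring
  have hn1 : (0 : ℝ) < (n : ℝ) - 1 := by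
    have : (2 : ℝ) ≤ n := by exact_mod_cast hn
    linarith
  have hg' : ContDiff ℝ 1 (deriv g) := (contDiff_succ_iff_deriv.mp hg).2.2
  have hg'' : Continuous (deriv (deriv g)) := hg'.continuous_deriv le_rfl
  have hp' : Function.Periodic (deriv g) 1 := Function.Periodic.deriv hgp
  have hFb : BddAbove (Set.range f) :=
    (Function.Periodic.compact_of_continuous hfp one_ne_zero hf.continuous).bddAbove
  have hgK : IsCompact (Set.range g) :=
    Function.Periodic.compact_of_continuous hgp one_ne_zero hg.continuous
  obtain ⟨y, hy⟩ := hgK.sInf_mem (Set.range_nonempty g)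
  have hPb : BddAbove (Set.range fun x => (deriv g x) ^ 2) :=
    ((hp'.comp fun z => z ^ 2).compact_of_continuous one_ne_zero
      ((continuous_pow 2).comp hg'.continuous)).bddAbove
  have hAb : BddAbove (Set.range fun x => |deriv (deriv g) x|) :=
    ((hp'.deriv.comp fun z => |z|).compact_of_continuous one_ne_zero hg''.abs).bddAbove
  have hC : C1 n f g ε = ε ^ 2 * sSup (Set.range fun x => |deriv (deriv g) x|) +
    sSup (Set.range f) * Real.sqrt (ε ^ 2 * sSup (Set.range fun x => (deriv g x) ^ 2) + 1) +
    2 * ((n : ℝ) - 1) / sInf (Set.range g) := rfl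
  have hF : ∀ x, f x ≤ sSup (Set.range f) := fun x => le_csSup hFb ⟨x, rfl⟩
  have hm : ∀ x, sInf (Set.range g) ≤ g x := fun x => csInf_le hgK.bddBelow ⟨x, rfl⟩
  have hP : ∀ x, (deriv g x) ^ 2 ≤ sSup (Set.range fun x => (deriv g x) ^ 2) :=
    fun x => le_csSup hPb ⟨x, rfl⟩
  have hA : ∀ x, |deriv (deriv g) x| ≤ sSup (Set.range fun x => |deriv (deriv g) x|) :=
    fun x => le_csSup hAb ⟨x, rfl⟩
  have hm0 : 0 < sInf (Set.range g) := hy ▸ hg0 y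
  generalize C1 n f g ε = C at *
  generalize sSup (Set.range f) = F at *
  generalize sInf (Set.range g) = m at *
  generalize sSup (Set.range fun x => (deriv g x) ^ 2) = P at *
  generalize sSup (Set.range fun x => |deriv (deriv g) x|) = A at *
  have hF0 : 0 < F := (hf0 0).trans_le (hF 0)
  have hA0 : 0 ≤ A := (abs_nonneg _).trans (hA 0)
  have hN : 0 < 2 * ((n : ℝ) - 1) / m := by positivity
  have hC0 : 0 < C := by rw [hC]; positivity
  have hCε : C / ε = ε * A + 1 / ε * (F * √(ε ^ 2 * P + 1)) + 1 / ε * (2 * ((n : ℝ) - 1) / m) := by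
    rw [hC]; field_simp
  have hcurv : ∀ x, |ε * deriv (deriv g) x / ((ε * deriv g x) ^ 2 + 1)| ≤ ε * A := fun x => by
    refine (abs_div_sq_add_one_le _ _).trans ?_
    rw [abs_mul, abs_of_pos hε]
    exact mul_le_mul_of_nonneg_left (hA x) hε.le
  have hforce : ∀ x, 1 / ε * f x * √((ε * deriv g x) ^ 2 + 1) ≤
      1 / ε * (F * √(ε ^ 2 * P + 1)) := fun x => by
    rw [mul_assoc, mul_pow]
    gcongr
    · exact hF x
    · exact hP x
  have hN' : 0 < 1 / ε * (2 * ((n : ℝ) - 1) / m) := by positivity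
  have hFS : 0 ≤ 1 / ε * (F * √(ε ^ 2 * P + 1)) := by positivity
  refine ⟨fun x t ht => ?_, fun x t ht htσ => ?_⟩
  · rw [pdt_eq_of_affine hψp, pdx_eq_of_affine hψp, pdxx_eq_of_affine hψp, hψp, hCε]
    have hg0x := hg0 x
    have hψ : 0 < ((n : ℝ) - 1) / (ε * g x + C / ε * t) := by positivity
    rw [hCε] at hψ
    linarith [(abs_le.mp (hcurv x)).2, hforce x]
  · have hψ : ε * m / 2 ≤ ψm x t := by
      have h1 : C / ε * t ≤ C / ε * (ε ^ 2 * m / (2 * C)) := by gcongr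
      have h2 : C / ε * (ε ^ 2 * m / (2 * C)) = ε * m / 2 := by field_simp
      have h3 : ε * m ≤ ε * g x := mul_le_mul_of_nonneg_left (hm x) hε.le
      rw [hψm]
      linarith
    have hεm : 0 < ε * m / 2 := by positivity
    refine ⟨⟨hεm, hψ⟩, ?_⟩
    rw [pdt_eq_of_affine hψm', pdx_eq_of_affine hψm', pdxx_eq_of_affine hψm', hCε]
    have h1 : ((n : ℝ) - 1) / ψm x t ≤ ((n : ℝ) - 1) / (ε * m / 2) := by gcongr
    have h2 : ((n : ℝ) - 1) / (ε * m / 2) = 1 / ε * (2 * ((n : ℝ) - 1) / m) := by field_simp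
    have hfx := hf0 x
    have h3 : 0 ≤ 1 / ε * f x * √((ε * deriv g x) ^ 2 + 1) := by positivity
    linarith [(abs_le.mp (hcurv x)).1]
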